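/- Let I be a directed poset, (D_i)_{i∈I} a system of complete extended metric spaces with nonexpanding connecting maps f_{ij} : D_i → D_j for i ≤ j, and let c_i : D_i → C (i ∈ I) be a compatible cocone of nonexpanding maps into a complete extended metric space C. Then the cocone is a colimit in the category of complete extended metric spaces and nonexpanding maps — meaning: for every complete extended metric space Y and every compatible family of nonexpanding maps h_i : D_i → Y there exists a unique nonexpanding map h : C → Y with h ∘ c_i = h_i for all i — if and only if: (1) ⋃_{i∈I} c_i[D_i] is dense in C, and (2) for every i ∈ I and all y, y' ∈ D_i one has d_C(c_i(y), c_i(y')) = inf_{j ≥ i} d_{D_j}(f_{ij}(y), f_{ij}(y')). -/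

import Mathlib

open ENNReal

/-- Truncation of an extended nonnegative real at a finite level, as a real number. -/
noncomputable def truncToReal (M : NNReal) (a : ℝ≥0∞) : ℝ := (min a M).toReal

lemma ofReal_truncToReal (M : NNReal) (a : ℝ≥0∞) : ENNReal.ofReal (truncToReal M a) = min a M :=
  ENNReal.ofReal_toReal (ne_top_of_le_ne_top ENNReal.coe_ne_top (min_le_right _ _))

lemma truncToReal_zero (M : NNReal) : truncToReal M 0 = 0 := by
  simp [truncToReal]

lemma edist_truncToReal_le (M : NNReal) {a b e : ℝ≥0∞} (hab : a ≤ b + e) (hba : b ≤ a + e) :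
    edist (truncToReal M a) (truncToReal M b) ≤ e := by
  have key : ∀ {x y : ℝ≥0∞}, x ≤ y + e →
      ENNReal.ofReal (truncToReal M x - truncToReal M y) ≤ e := by
    intro x y hxy
    rw [ENNReal.ofReal_sub _ (q := truncToReal M y) ENNReal.toReal_nonneg, ofReal_truncToReal, ofReal_truncToReal,
      tsub_le_iff_left]
    rcases le_total y M with h | h
    · rw [min_eq_left h]
      exact (min_le_left _ _).trans hxy
    · rw [min_eq_right h]
      exact (min_le_right _ _).trans le_self_add
  rw [edist_dist, Real.dist_eq]
  rcases abs_choice (truncToReal M a - truncToReal M b) with h | h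
  · rw [h]
    exact key hab
  · rw [h, neg_sub]
    exact key hba

/-- A function into a complete space that is dominated by a map with dense range factors through
a nonexpanding map on the whole target. -/
lemma exists_nonexpanding_factor {S C Y : Type*} [EMetricSpace C] [EMetricSpace Y]
    [CompleteSpace Y] (e : S → C) (he : DenseRange e) (φ : S → Y)
    (hφ : ∀ s t, edist (φ s) (φ t) ≤ edist (e s) (e t)) :
    ∃ g : C → Y, (∀ x y, edist (g x) (g y) ≤ edist x y) ∧ ∀ s, g (e s) = φ s := by
  choose r hr using fun a : Set.range e => a.2
  let ψ : Set.range e → Y := fun a => φ (r a)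
  have hψ : LipschitzWith 1 ψ := by
    intro a b
    simpa [ψ, hr, Subtype.edist_eq] using hφ (r a) (r b)
  have hd : Dense (Set.range e) := he
  have hc : Continuous (hd.extend ψ) :=
    (hd.uniformContinuous_extend hψ.uniformContinuous).continuous
  have hval : ∀ s, hd.extend ψ (e s) = φ s := by
    intro s
    have h1 := hd.extend_eq hψ.continuous ⟨e s, s, rfl⟩
    rw [h1, ← edist_le_zero]
    refine (hφ _ _).trans ?_
    simp [hr]
  refine ⟨hd.extend ψ, fun x y => ?_, hval⟩
  refine he.induction_on₂ (p := fun x y => edist (hd.extend ψ x) (hd.extend ψ y) ≤ edist x y)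
    ?_ ?_ x y
  · exact isClosed_le ((hc.comp continuous_fst).edist (hc.comp continuous_snd)) continuous_edist
  · intro s t
    rw [hval, hval]
    exact hφ s t

/-- A cocone over a directed system of complete extended metric spaces with
nonexpanding connecting maps is a colimit in the category of complete extended metric
spaces and nonexpanding maps iff it is collectively dense and the distances in the
vertex are computed by the infimum formula. -/
theorem directed_colimit_complete_emetric_characterization.{u, v, w}
    {I : Type u} [PartialOrder I] [IsDirected I (· ≤ ·)] [Nonempty I]
    (D : I → Type v) [∀ i, EMetricSpace (D i)] [∀ i, CompleteSpace (D i)]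
    (f : ∀ i j, i ≤ j → D i → D j)
    (hf_ne : ∀ i j (h : i ≤ j) (x y : D i), edist (f i j h x) (f i j h y) ≤ edist x y)
    (hf_id : ∀ i (x : D i), f i i le_rfl x = x)
    (hf_comp : ∀ i j k (hij : i ≤ j) (hjk : j ≤ k) (x : D i),
      f j k hjk (f i j hij x) = f i k (hij.trans hjk) x)
    (C : Type v) [EMetricSpace C] [CompleteSpace C]
    (c : ∀ i, D i → C)
    (hc_ne : ∀ i (x y : D i), edist (c i x) (c i y) ≤ edist x y)
    (hc_compat : ∀ i j (h : i ≤ j) (x : D i), c j (f i j h x) = c i x) :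
    (∀ (Y : Type w) [EMetricSpace Y] [CompleteSpace Y] (h : ∀ i, D i → Y),
        (∀ i (x y : D i), edist (h i x) (h i y) ≤ edist x y) →
        (∀ i j (hij : i ≤ j) (x : D i), h j (f i j hij x) = h i x) →
        ∃! g : C → Y,
          (∀ x y : C, edist (g x) (g y) ≤ edist x y) ∧ ∀ i (x : D i), g (c i x) = h i x)
    ↔ (Dense (⋃ i, Set.range (c i)) ∧
       (∀ i (y y' : D i), edist (c i y) (c i y') =
          ⨅ j : {j : I // i ≤ j}, edist (f i j.1 j.2 y) (f i j.1 j.2 y'))) := by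
  constructor
  · intro huniv
    refine ⟨fun x => ?_, fun i y y' => le_antisymm ?_ ?_⟩
    · set A := ⋃ i, Set.range (c i)
      obtain ⟨g, -, hg⟩ := huniv (ULift ℝ) (fun _ _ => ⟨0⟩) (by simp) (by simp)
      have h0 := hg (fun _ => ⟨0⟩) ⟨by simp, by simp⟩
      have h1 := hg (fun z => ⟨truncToReal 1 (Metric.infEDist z A)⟩) ⟨fun a b => ?_, fun i z => ?_⟩
      · have h2 : truncToReal 1 (Metric.infEDist x A) = 0 :=
          congrArg ULift.down (congrFun (h1.trans h0.symm) x)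
        have h3 := ofReal_truncToReal 1 (Metric.infEDist x A)
        rw [h2, ENNReal.ofReal_zero] at h3
        rw [Metric.mem_closure_iff_infEDist_zero]
        rcases min_choice (Metric.infEDist x A) ((1 : NNReal) : ℝ≥0∞) with h | h
        · rw [← h, ← h3]
        · rw [h] at h3
          simp at h3
      · refine edist_truncToReal_le 1 Metric.infEDist_le_infEDist_add_edist ?_
        rw [edist_comm]
        exact Metric.infEDist_le_infEDist_add_edist
      · have : Metric.infEDist (c i z) A = 0 :=
          Metric.infEDist_zero_of_mem (Set.mem_iUnion.2 ⟨i, z, rfl⟩)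
        dsimp only
        rw [this, truncToReal_zero]
    · refine le_iInf fun j => ?_
      rw [← hc_compat i j.1 j.2 y, ← hc_compat i j.1 j.2 y']
      exact hc_ne _ _ _
    · let δ : ∀ j, D j → ℝ≥0∞ := fun j z =>
        ⨅ k : {k : I // i ≤ k ∧ j ≤ k}, edist (f j k.1 k.2.2 z) (f i k.1 k.2.1 y)
      have hδ : ∀ j (z z' : D j), δ j z ≤ δ j z' + edist z z' := by
        intro j z z'
        simp only [δ, ENNReal.iInf_add]
        refine le_iInf fun k => iInf_le_of_le k ?_
        refine (edist_triangle _ (f j k.1 k.2.2 z') _).trans ?_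
        rw [add_comm]
        gcongr
        exact hf_ne _ _ _ _ _
      have hδf : ∀ j k (hjk : j ≤ k) (z : D j), δ k (f j k hjk z) = δ j z := by
        intro j k hjk z
        refine le_antisymm (le_iInf fun l => ?_) (le_iInf fun l => ?_)
        · obtain ⟨m, hlm, hkm⟩ := exists_ge_ge l.1 k
          refine iInf_le_of_le ⟨m, l.2.1.trans hlm, hkm⟩ ?_
          rw [hf_comp, ← hf_comp j l.1 m l.2.2 hlm, ← hf_comp i l.1 m l.2.1 hlm]
          exact hf_ne _ _ _ _ _
        · refine iInf_le_of_le ⟨l.1, l.2.1, hjk.trans l.2.2⟩ ?_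
          rw [hf_comp]
      have hδy : δ i y = 0 :=
        le_antisymm (iInf_le_of_le ⟨i, le_rfl, le_rfl⟩ (by simp)) zero_le
      have hle : (⨅ j : {j : I // i ≤ j}, edist (f i j.1 j.2 y) (f i j.1 j.2 y')) ≤ δ i y' := by
        refine le_iInf fun k => iInf_le_of_le ⟨k.1, k.2.1⟩ ?_
        rw [edist_comm]
      refine hle.trans (ENNReal.le_of_forall_nnreal_lt fun M hM => ?_)
      obtain ⟨g, ⟨hg, hgc⟩, -⟩ := huniv (ULift ℝ) (fun j z => ⟨truncToReal M (δ j z)⟩)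
        (fun j z z' => edist_truncToReal_le M (hδ j z z') (by rw [edist_comm]; exact hδ j z' z))
        (fun j k hjk z => by rw [hδf])
      have h1 := hg (c i y') (c i y)
      rw [hgc, hgc, edist_comm (c i y')] at h1
      have h2 : edist (truncToReal M (δ i y')) (truncToReal M (δ i y)) ≤ edist (c i y) (c i y') := h1
      rw [hδy, truncToReal_zero, edist_dist, Real.dist_0_eq_abs,
        abs_of_nonneg (by exact ENNReal.toReal_nonneg), ofReal_truncToReal, min_eq_right hM.le] at h2
      exact h2
  · rintro ⟨hdense, hinf⟩ Y _ _ h hne hcompat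
    have hrange : (⋃ i, Set.range (c i)) = Set.range fun s : Σ i, D i => c s.1 s.2 :=
      (Set.range_sigma_eq_iUnion_range fun s : Σ i, D i => c s.1 s.2).symm
    have he : DenseRange fun s : Σ i, D i => c s.1 s.2 := by
      rwa [DenseRange, ← hrange]
    obtain ⟨g, hg, hgc⟩ := exists_nonexpanding_factor _ he (fun s => h s.1 s.2) (by
      rintro ⟨i, x⟩ ⟨j, y⟩
      obtain ⟨k, hik, hjk⟩ := exists_ge_ge i j
      dsimp only
      rw [← hc_compat i k hik, ← hc_compat j k hjk, hinf]
      refine le_iInf fun l => ?_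
      rw [← hcompat i k hik, ← hcompat j k hjk, ← hcompat k l.1 l.2, ← hcompat k l.1 l.2 (f j k _ y)]
      exact hne _ _ _)
    refine ⟨g, ⟨hg, fun i x => hgc ⟨i, x⟩⟩, ?_⟩
    rintro g' ⟨hg', hgc'⟩
    have hcont : ∀ {k : C → Y}, (∀ x y, edist (k x) (k y) ≤ edist x y) → Continuous k := by
      intro k hk
      have : LipschitzWith 1 k := fun x y => by simpa using hk x y
      exact this.continuous
    refine he.equalizer (hcont hg') (hcont hg) (funext fun s => ?_)
    exact (hgc' s.1 s.2).trans (hgc s).symm
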